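/- Let k, F, d be positive integers and let f : (ℝ^F)^k → ℝ^d be a permutation-invariant multilinear polynomial map. Then there exists a tensor T : {1,…,F+1}^k × {1,…,d} → ℝ that is partially symmetric with respect to its first k modes and satisfies f(x_1,…,x_k)_i = ∑_{J ∈ {1,…,F+1}^k} T(J, i) ∏_{ℓ=1}^k (x̃_ℓ)_{J(ℓ)} for all x_1,…,x_k ∈ ℝ^F and all i ∈ {1,…,d}. -/

import Mathlib

/-- Homogeneous coordinates of a vector `x ∈ ℝ^F`: append an entry equal to `1`. -/
def homCoord {F : ℕ} (x : Fin F → ℝ) : Fin (F + 1) → ℝ := Fin.snoc x 1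

open Finset in
/-- A multilinear polynomial is the contraction of a tensor in homogeneous coordinates: a factor
with exponent `0` is read as the last homogeneous coordinate. -/
lemma exists_tensor_of_multilinear_polynomial {k F : ℕ}
    (τ : (Fin k → Fin F) → (Fin k → Fin 2) → ℝ) :
    ∃ S : (Fin k → Fin (F + 1)) → ℝ, ∀ x : Fin k → Fin F → ℝ,
      ∑ J, ∑ ι, τ J ι * ∏ ℓ, (x ℓ (J ℓ)) ^ (ι ℓ : ℕ) =
        ∑ J, S J * ∏ ℓ, homCoord (x ℓ) (J ℓ) := by
  let h : (Fin k → Fin F) × (Fin k → Fin 2) → Fin k → Fin (F + 1) :=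
    fun p ℓ ↦ if p.2 ℓ = 0 then Fin.last F else (p.1 ℓ).castSucc
  have monomial_eq (x : Fin k → Fin F → ℝ) (p : (Fin k → Fin F) × (Fin k → Fin 2)) :
      ∏ ℓ, (x ℓ (p.1 ℓ)) ^ (p.2 ℓ : ℕ) = ∏ ℓ, homCoord (x ℓ) (h p ℓ) := by
    refine prod_congr rfl fun ℓ _ ↦ ?_
    rcases Fin.exists_fin_two.mp ⟨p.2 ℓ, rfl⟩ with h0 | h1
    · simp [h, homCoord, h0]
    · simp [h, homCoord, h1]
  refine ⟨fun J ↦ ∑ p with h p = J, τ p.1 p.2, fun x ↦ ?_⟩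
  rw [← Fintype.sum_prod_type' (f := fun J ι ↦ τ J ι * ∏ ℓ, (x ℓ (J ℓ)) ^ (ι ℓ : ℕ)),
    ← sum_fiberwise univ h]
  refine sum_congr rfl fun J _ ↦ ?_
  rw [sum_mul]
  refine sum_congr rfl fun p hp ↦ ?_
  rw [monomial_eq, (mem_filter.mp hp).2]

/-- Permuting the indices of a tensor permutes the vectors it is contracted with. -/
lemma sum_comp_perm_mul_prod {k n : ℕ} (S : (Fin k → Fin n) → ℝ) (y : Fin k → Fin n → ℝ)
    (φ : Equiv.Perm (Fin k)) :
    ∑ J, S (J ∘ φ) * ∏ ℓ, y ℓ (J ℓ) = ∑ J, S J * ∏ ℓ, y (φ ℓ) (J ℓ) := by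
  refine Fintype.sum_equiv (φ.symm.arrowCongr (Equiv.refl (Fin n))) _ _ fun J ↦ ?_
  congr 1
  exact (Equiv.prod_comp φ fun ℓ ↦ y ℓ (J ℓ)).symm

/-- Every permutation-invariant multilinear polynomial map is the contraction of a
tensor, in homogeneous coordinates, which is partially symmetric with respect to its
first `k` modes. -/
theorem perm_invariant_multilinear_map_as_partially_symmetric_tensor
    (k F d : ℕ) (hk : 0 < k) (hF : 0 < F) (hd : 0 < d)
    (f : (Fin k → Fin F → ℝ) → Fin d → ℝ)
    (hf : ∃ τ : Fin d → (Fin k → Fin F) → (Fin k → Fin 2) → ℝ,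
      ∀ (x : Fin k → Fin F → ℝ) (i : Fin d),
        f x i = ∑ J : Fin k → Fin F, ∑ ι : Fin k → Fin 2,
          τ i J ι * ∏ ℓ : Fin k, (x ℓ (J ℓ)) ^ (ι ℓ : ℕ))
    (hperm : ∀ (φ : Equiv.Perm (Fin k)) (x : Fin k → Fin F → ℝ), f (x ∘ φ) = f x) :
    ∃ T : (Fin k → Fin (F + 1)) → Fin d → ℝ,
      (∀ (φ : Equiv.Perm (Fin k)) (J : Fin k → Fin (F + 1)) (i : Fin d),
        T (J ∘ φ) i = T J i) ∧
      ∀ (x : Fin k → Fin F → ℝ) (i : Fin d),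
        f x i = ∑ J : Fin k → Fin (F + 1),
          T J i * ∏ ℓ : Fin k, homCoord (x ℓ) (J ℓ) := by
  choose τ hτ using hf
  choose S hS using fun i ↦ exists_tensor_of_multilinear_polynomial (τ i)
  refine ⟨fun J i ↦ (k.factorial : ℝ)⁻¹ * ∑ φ : Equiv.Perm (Fin k), S i (J ∘ φ), ?_, ?_⟩
  · intro φ J i
    exact congrArg _ <|
      Equiv.sum_comp (Equiv.mulLeft φ) fun ψ : Equiv.Perm (Fin k) ↦ S i (J ∘ ψ)
  · intro x i
    have contraction_perm (φ : Equiv.Perm (Fin k)) :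
        ∑ J, S i (J ∘ φ) * ∏ ℓ, homCoord (x ℓ) (J ℓ) = f x i := by
      rw [sum_comp_perm_mul_prod (S i) (fun ℓ ↦ homCoord (x ℓ)), ← hperm φ x, hτ, hS]
      rfl
    simp_rw [mul_assoc, ← Finset.mul_sum, Finset.sum_mul]
    rw [Finset.sum_comm]
    simp [contraction_perm, Fintype.card_perm, Nat.factorial_ne_zero]
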